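/- Assume (H0)–(H4). Let 𝒱(t,x) be the value function of the state-constrained Bolza problem: 𝒱(t,x) = inf{ φ(x(T)) + ∫ₜᵀ ℓ(s,x(s),u(s)) ds : (x,u) ∈ 𝕏_{[t,T]}(x), g(x(s)) ≤ 0 on [t,T], g_f(x(T)) ≤ 0 } (with inf ∅ = +∞). Let 𝒲(t,x,z) = inf over augmented trajectories (x,ζ) ∈ 𝒮_{[t,T]}(x,z) of max( φ(x(T)) − ζ(T), max_{θ∈[t,T]} G(x(θ)), G_f(x(T)) ), where G = max_i g_i, G_f = max_j g_{f,j}, and ζ̇ = −ℓ(s,x(s),u(s)), ζ(t) = z. Then for all (t,x,z): 𝒱(t,x) ≤ z if and only if 𝒲(t,x,z) ≤ 0. -/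

import Mathlib

open Set MeasureTheory intervalIntegral

variable {d r mg mf : ℕ}

/-- Admissible control–trajectory pairs on `[t,T]` starting at `x₀` at time `t`. -/
def BolzaAdm (U : Set (Fin r → ℝ))
    (f : ℝ → EuclideanSpace ℝ (Fin d) → (Fin r → ℝ) → EuclideanSpace ℝ (Fin d))
    (t T : ℝ) (x₀ : EuclideanSpace ℝ (Fin d))
    (traj : ℝ → EuclideanSpace ℝ (Fin d)) (u : ℝ → (Fin r → ℝ)) : Prop :=
  Measurable u ∧ (∀ s, u s ∈ U) ∧ traj t = x₀ ∧
    ∀ s ∈ Icc t T, traj s = x₀ + ∫ τ in t..s, f τ (traj τ) (u τ)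

/-- Value function (in `EReal`, with `inf ∅ = +∞`) of the state-constrained Bolza
problem. -/
noncomputable def ConstrainedBolzaValue (U : Set (Fin r → ℝ))
    (f : ℝ → EuclideanSpace ℝ (Fin d) → (Fin r → ℝ) → EuclideanSpace ℝ (Fin d))
    (l : ℝ → EuclideanSpace ℝ (Fin d) → (Fin r → ℝ) → ℝ)
    (φ : EuclideanSpace ℝ (Fin d) → ℝ)
    (g : EuclideanSpace ℝ (Fin d) → Fin mg → ℝ)
    (g_f : EuclideanSpace ℝ (Fin d) → Fin mf → ℝ)
    (T t : ℝ) (x : EuclideanSpace ℝ (Fin d)) : EReal :=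
  sInf {c : EReal | ∃ traj u, BolzaAdm U f t T x traj u ∧
    (∀ s ∈ Icc t T, ∀ i, g (traj s) i ≤ 0) ∧ (∀ j, g_f (traj T) j ≤ 0) ∧
    c = ((φ (traj T) + ∫ s in t..T, l s (traj s) (u s) : ℝ) : EReal)}

/-- Auxiliary (max-penalized) value function `𝒲(t,x,z)` on the augmented state space. -/
noncomputable def AuxValue (U : Set (Fin r → ℝ))
    (f : ℝ → EuclideanSpace ℝ (Fin d) → (Fin r → ℝ) → EuclideanSpace ℝ (Fin d))
    (l : ℝ → EuclideanSpace ℝ (Fin d) → (Fin r → ℝ) → ℝ)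
    (φ : EuclideanSpace ℝ (Fin d) → ℝ)
    (g : EuclideanSpace ℝ (Fin d) → Fin mg → ℝ)
    (g_f : EuclideanSpace ℝ (Fin d) → Fin mf → ℝ)
    (T t : ℝ) (x : EuclideanSpace ℝ (Fin d)) (z : ℝ) : ℝ :=
  sInf {c : ℝ | ∃ traj u, BolzaAdm U f t T x traj u ∧
    c = max (φ (traj T) + (∫ s in t..T, l s (traj s) (u s)) - z)
          (max (sSup ((fun θ => ⨆ i, g (traj θ) i) '' Icc t T))
               (⨆ j, g_f (traj T) j))}

open Filter Topology Metric

lemma bz_selection {P V : Type*} [TopologicalSpace P] [MeasurableSpace P] [BorelSpace P]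
    [MetricSpace V] [MeasurableSpace V] [BorelSpace V] (U : Set V) (hU : IsCompact U)
    (hne : U.Nonempty) (K : Set (P × V)) (hK : IsClosed K) :
    ∃ σ : P → V, Measurable σ ∧ (∀ p, σ p ∈ U) ∧
      ∀ p, ∀ v ∈ U, (p, v) ∈ K → (p, σ p) ∈ K := by
  classical
  have : Nonempty U := hne.to_subtype
  have : CompactSpace U := isCompact_iff_compactSpace.mp hU
  have : CompactSpace cantorSet := isCompact_iff_compactSpace.mp isCompact_cantorSet
  obtain ⟨c0, hc0, hc0s⟩ := exists_nat_bool_continuous_surjective_of_compact U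
  let c : cantorSet → V := fun a => (c0 (cantorSetHomeomorphNatToBool a) : V)
  have hc : Continuous c :=
    continuous_subtype_val.comp (hc0.comp cantorSetHomeomorphNatToBool.continuous)
  have hcs : ∀ v ∈ U, ∃ a, c a = v := by
    intro v hv
    obtain ⟨b, hb⟩ := hc0s ⟨v, hv⟩
    refine ⟨cantorSetHomeomorphNatToBool.symm b, ?_⟩
    simp [c, hb]
  have hclosed : ∀ b : ℝ, IsClosed {p : P | ∃ a : cantorSet, (a : ℝ) ≤ b ∧ (p, c a) ∈ K} := by
    intro b
    have h1 : IsClosed {q : P × cantorSet | (q.2 : ℝ) ≤ b ∧ (q.1, c q.2) ∈ K} := by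
      apply IsClosed.inter
      · exact isClosed_le (continuous_subtype_val.comp continuous_snd) continuous_const
      · exact hK.preimage (continuous_fst.prodMk (hc.comp continuous_snd))
    have h2 := isClosedMap_fst_of_compactSpace _ h1
    convert h2 using 1
    ext p
    simp
  have hD : ∀ p : P, (∃ a, (p, c a) ∈ K) →
      ∃ a : cantorSet, (p, c a) ∈ K ∧ ∀ a', (p, c a') ∈ K → a ≤ a' := by
    intro p hp
    have h1 : IsClosed {a : cantorSet | (p, c a) ∈ K} :=
      hK.preimage (continuous_const.prodMk hc)
    obtain ⟨a, ha⟩ := h1.isCompact.exists_isLeast hp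
    exact ⟨a, ha.1, fun a' h' => ha.2 h'⟩
  let z0 : cantorSet := ⟨0, zero_mem_cantorSet⟩
  let m : P → cantorSet := fun p => if h : ∃ a, (p, c a) ∈ K then (hD p h).choose else z0
  have hm1 : ∀ p, (∃ a, (p, c a) ∈ K) → (p, c (m p)) ∈ K ∧ ∀ a', (p, c a') ∈ K → m p ≤ a' := by
    intro p h
    simp only [m, dif_pos h]
    exact (hD p h).choose_spec
  have hm2 : ∀ p, ¬ (∃ a, (p, c a) ∈ K) → m p = z0 := by
    intro p h
    simp only [m, dif_neg h]
  have hDm : MeasurableSet {p : P | ∃ a, (p, c a) ∈ K} := by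
    have := (hclosed 1).measurableSet
    convert this using 1
    ext p
    constructor
    · rintro ⟨a, ha⟩
      exact ⟨a, (cantorSet_subset_unitInterval a.2).2, ha⟩
    · rintro ⟨a, _, ha⟩
      exact ⟨a, ha⟩
  have hmm : Measurable (fun p => (m p : ℝ)) := by
    apply measurable_of_Iic
    intro b
    have : (fun p => (m p : ℝ)) ⁻¹' Iic b = {p : P | ∃ a : cantorSet, (a : ℝ) ≤ b ∧ (p, c a) ∈ K}
        ∪ ({p : P | ∃ a, (p, c a) ∈ K}ᶜ ∩ {p | (0:ℝ) ≤ b}) := by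
      ext p
      simp only [mem_preimage, mem_Iic, mem_union, mem_ofPred_eq, mem_inter_iff, mem_compl_iff]
      by_cases h : ∃ a, (p, c a) ∈ K
      · constructor
        · intro h'
          exact Or.inl ⟨m p, h', (hm1 p h).1⟩
        · rintro (⟨a, hab, haK⟩ | h')
          · exact le_trans ((hm1 p h).2 a haK) hab
          · exact absurd h h'.1
      · rw [hm2 p h]
        constructor
        · intro h'
          exact Or.inr ⟨h, h'⟩
        · rintro (⟨a, hab, haK⟩ | h')
          · exact absurd ⟨a, haK⟩ h
          · exact h'.2
    rw [this]
    exact (hclosed b).measurableSet.union (hDm.compl.inter (MeasurableSet.const _))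
  refine ⟨fun p => c (m p), hc.measurable.comp hmm.subtype_mk, fun p => (c0 _).2, ?_⟩
  intro p v hv hp
  obtain ⟨a, rfl⟩ := hcs v hv
  exact (hm1 p ⟨a, hp⟩).1

lemma bz_ftc {W : Type*} [NormedAddCommGroup W] [NormedSpace ℝ W] [FiniteDimensional ℝ W]
    {C : NNReal} (y : ℝ → W) (hy : LipschitzWith C y) (a b : ℝ) :
    IntervalIntegrable (deriv y) volume a b ∧ ∫ s in a..b, deriv y s = y b - y a := by
  have : CompleteSpace W := FiniteDimensional.complete ℝ W
  have hint : IntervalIntegrable (deriv y) volume a b := by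
    apply (intervalIntegrable_const (c := (C:ℝ)) (μ := volume) (a := a) (b := b)).mono_fun
    · exact (stronglyMeasurable_deriv y).aestronglyMeasurable
    · refine ae_of_all _ fun s => ?_
      simpa using norm_deriv_le_of_lipschitz hy
  refine ⟨hint, ?_⟩
  rw [SeparatingDual.eq_iff_forall_dual_eq (R := ℝ)]
  intro g
  rw [← g.intervalIntegral_comp_comm hint, map_sub]
  have hgy : LipschitzWith (‖g‖₊ * C) (fun s => g (y s)) := g.lipschitz.comp hy
  have hac : AbsolutelyContinuousOnInterval (fun s => g (y s)) a b :=
    (hgy.lipschitzOnWith (s := uIcc a b)).absolutelyContinuousOnInterval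
  rw [← hac.integral_deriv_eq_sub]
  apply intervalIntegral.integral_congr_ae
  filter_upwards [hy.ae_differentiableAt_real] with s hs _
  exact ((g.hasFDerivAt.comp_hasDerivAt s hs.hasDerivAt).deriv).symm

lemma bz_deriv_mem {W : Type*} [NormedAddCommGroup W] [NormedSpace ℝ W] [FiniteDimensional ℝ W]
    (𝒰 : Ultrafilter ℕ) (v : ℕ → ℝ → W) (Y : ℕ → ℝ → W) (Z : ℝ → W) (t T s : ℝ)
    (hs : s ∈ Ico t T) (hv : ∀ n, ∀ a ∈ Icc t T, ∀ b ∈ Icc t T, IntervalIntegrable (v n) volume a b)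
    (hY : ∀ n, ∀ a ∈ Icc t T, ∀ b ∈ Icc t T, Y n b - Y n a = ∫ τ in a..b, v n τ)
    (hZ : ∀ a ∈ Icc t T, Tendsto (fun n => Y n a) 𝒰 (𝓝 (Z a)))
    (D : W) (hD : HasDerivAt Z D s) (C : Set W) (hC : Convex ℝ C) (hCc : IsClosed C)
    (h : ∀ ε > 0, ∃ δ > 0, ∀ᶠ n in 𝒰, ∀ τ ∈ Icc s (s + δ), τ ≤ T → v n τ ∈ cthickening ε C) :
    D ∈ C := by
  have : CompleteSpace W := FiniteDimensional.complete ℝ W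
  rw [← hCc.closure_eq, closure_eq_iInter_cthickening]
  simp only [mem_iInter]
  intro ε hε
  obtain ⟨δ, hδ, hn⟩ := h ε hε
  have hslope : Tendsto (fun b => (b - s)⁻¹ • (Z b - Z s)) (𝓝[>] s) (𝓝 D) := by
    have := hD.hasDerivWithinAt (s := Ioi s)
    rw [hasDerivWithinAt_iff_tendsto_slope' (by simp)] at this
    exact this
  refine isClosed_cthickening.mem_of_tendsto hslope ?_
  have hev : Ioo s (min (s + δ) T) ∈ 𝓝[>] s :=
    Ioo_mem_nhdsGT (lt_min (by linarith) hs.2)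
  filter_upwards [hev] with b hb
  have hbT : b ≤ T := hb.2.le.trans (min_le_right _ _)
  have hbδ : b ≤ s + δ := hb.2.le.trans (min_le_left _ _)
  have hsI : s ∈ Icc t T := ⟨hs.1, hs.2.le⟩
  have hbI : b ∈ Icc t T := ⟨hs.1.trans hb.1.le, hbT⟩
  have hlim : Tendsto (fun n => (b - s)⁻¹ • (Y n b - Y n s)) 𝒰 (𝓝 ((b - s)⁻¹ • (Z b - Z s))) :=
    ((hZ b hbI).sub (hZ s hsI)).const_smul _
  refine isClosed_cthickening.mem_of_tendsto hlim ?_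
  filter_upwards [hn] with n hn
  rw [hY n s hsI b hbI, ← interval_average_eq]
  rw [uIoc_of_le hb.1.le]
  apply (hC.cthickening ε).set_average_mem isClosed_cthickening
  · simp [hb.1]
  · simp
  · refine (ae_restrict_iff' measurableSet_Ioc).mpr (ae_of_all _ fun τ hτ => ?_)
    exact hn τ ⟨hτ.1.le, hτ.2.trans hbδ⟩ (hτ.2.trans hbT)
  · exact (intervalIntegrable_iff_integrableOn_Ioc_of_le hb.1.le).mp (hv n s hsI b hbI)

lemma bz_aesm {E V F : Type*} [TopologicalSpace E] [SecondCountableTopology E] [MeasurableSpace E]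
    [BorelSpace E] [TopologicalSpace V] [SecondCountableTopology V] [MeasurableSpace V]
    [BorelSpace V] [NormedAddCommGroup F] [SecondCountableTopology F]
    (U : Set V) (hU : IsClosed U) (T : ℝ) (h : ℝ → E → V → F)
    (hcont : ContinuousOn (fun p : ℝ × E × V => h p.1 p.2.1 p.2.2) (Icc 0 T ×ˢ univ ×ˢ U))
    (S : Set ℝ) (hS : MeasurableSet S) (hST : S ⊆ Icc 0 T) (x : ℝ → E)
    (hx : AEMeasurable x (volume.restrict S)) (u : ℝ → V) (hu : Measurable u)
    (huU : ∀ s, u s ∈ U) :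
    AEStronglyMeasurable (fun τ => h τ (x τ) (u τ)) (volume.restrict S) := by
  classical
  borelize F
  have hSm : MeasurableSet (Icc 0 T ×ˢ (univ : Set E) ×ˢ U) :=
    measurableSet_Icc.prod (MeasurableSet.univ.prod hU.measurableSet)
  have hm : Measurable (indicator (Icc 0 T ×ˢ (univ : Set E) ×ˢ U)
      (fun p : ℝ × E × V => h p.1 p.2.1 p.2.2)) := by
    have := hcont.measurable_piecewise (g := (0 : ℝ × E × V → F)) continuousOn_const hSm
    rwa [piecewise_eq_indicator] at this
  have hp : AEMeasurable (fun τ => (τ, x τ, u τ)) (volume.restrict S) :=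
    aemeasurable_id.prodMk (hx.prodMk hu.aemeasurable)
  have := hm.comp_aemeasurable hp
  refine (this.congr ?_).aestronglyMeasurable
  refine (ae_restrict_iff' hS).mpr (ae_of_all _ fun τ hτ => ?_)
  simp only [Function.comp]
  rw [indicator_of_mem]
  exact ⟨hST hτ, mem_univ _, huU τ⟩

lemma bz_gronwall {E : Type*} [NormedAddCommGroup E] [NormedSpace ℝ E] [CompleteSpace E]
    (h : ℝ → E) (X : ℝ → E) (t s c : ℝ) (hts : t ≤ s) (hc : 0 < c) (x : E)
    (hX : ∀ r ∈ Icc t s, X r = x + ∫ τ in t..r, h τ)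
    (hb : ∀ r ∈ Icc t s, ‖h r‖ ≤ c * (1 + ‖X r‖))
    (hint : IntervalIntegrable h volume t s) :
    ContinuousOn X (Icc t s) ∧ ∀ r ∈ Icc t s, ‖X r‖ ≤ (1 + ‖x‖) * Real.exp (c * (r - t)) := by
  have hcont : ContinuousOn X (Icc t s) := by
    have h1 := intervalIntegral.continuousOn_primitive_interval (μ := volume) (f := h) (a := t) (b := s)
      (by rw [← intervalIntegrable_iff']; exact hint)
    rw [uIcc_of_le hts] at h1
    exact (continuousOn_const.add h1).congr hX
  refine ⟨hcont, ?_⟩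
  let cl : ℝ → ℝ := fun r => max t (min r s)
  have hclc : Continuous cl := by fun_prop
  have hclI : ∀ r, cl r ∈ Icc t s := fun r => ⟨le_max_left _ _, max_le hts (min_le_right _ _)⟩
  have hcle : ∀ r ∈ Icc t s, cl r = r := fun r hr => by
    simp only [cl]; rw [min_eq_left hr.2, max_eq_right hr.1]
  let N : ℝ → ℝ := fun r => c * (1 + ‖X (cl r)‖)
  have hN : Continuous N := by
    have : Continuous (fun r => X (cl r)) :=
      hcont.comp_continuous hclc hclI
    exact continuous_const.mul (continuous_const.add this.norm)
  have hN0 : ∀ r, 0 ≤ N r := fun r => by positivity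
  let G : ℝ → ℝ := fun r => 1 + ‖x‖ + ∫ τ in t..r, N τ
  have hG : ∀ r, HasDerivAt G (N r) r := fun r => by
    exact (intervalIntegral.integral_hasDerivAt_right (hN.intervalIntegrable _ _)
      hN.aestronglyMeasurable.stronglyMeasurableAtFilter hN.continuousAt).const_add _
  have hG0 : ∀ r ∈ Icc t s, 0 ≤ ∫ τ in t..r, N τ := fun r hr =>
    intervalIntegral.integral_nonneg hr.1 (fun τ _ => hN0 τ)
  have hXG : ∀ r ∈ Icc t s, 1 + ‖X r‖ ≤ G r := by
    intro r hr
    have h1 : ‖∫ τ in t..r, h τ‖ ≤ ∫ τ in t..r, N τ := by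
      apply intervalIntegral.norm_integral_le_of_norm_le hr.1 _ (hN.intervalIntegrable _ _)
      refine ae_of_all _ fun τ hτ => ?_
      have hτI : τ ∈ Icc t s := ⟨hτ.1.le, hτ.2.trans hr.2⟩
      have := hb τ hτI
      simp only [N, hcle τ hτI]
      exact this
    rw [hX r hr]
    have := norm_add_le x (∫ τ in t..r, h τ)
    simp only [G]
    linarith
  have := norm_le_gronwallBound_of_norm_deriv_right_le (f := G) (f' := N) (δ := 1 + ‖x‖) (K := c)
    (ε := 0) (a := t) (b := s) (fun r _ => (hG r).continuousAt.continuousWithinAt)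
    (fun r _ => (hG r).hasDerivWithinAt)
    (by simp only [G, intervalIntegral.integral_same, add_zero]
        rw [Real.norm_of_nonneg (by positivity)])
    (by
      intro r hr
      have hrI : r ∈ Icc t s := ⟨hr.1, hr.2.le⟩
      have h1 := hXG r hrI
      rw [Real.norm_of_nonneg (hN0 r), add_zero]
      simp only [N, hcle r hrI]
      exact mul_le_mul_of_nonneg_left (h1.trans (le_abs_self _)) hc.le)
  intro r hr
  have h1 := this r hr
  rw [gronwallBound_ε0] at h1
  have h2 := hXG r hr
  have h3 := le_abs_self (G r)
  rw [Real.norm_eq_abs] at h1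
  linarith

lemma bz_apriori {d r : ℕ} (T : ℝ) (U : Set (Fin r → ℝ)) (hUc : IsCompact U)
    (f : ℝ → EuclideanSpace ℝ (Fin d) → (Fin r → ℝ) → EuclideanSpace ℝ (Fin d))
    (hf_cont : ContinuousOn (fun p : ℝ × EuclideanSpace ℝ (Fin d) × (Fin r → ℝ) =>
      f p.1 p.2.1 p.2.2) (Icc 0 T ×ˢ univ ×ˢ U))
    (c_f : ℝ) (hc_f : 0 < c_f)
    (hf_growth : ∀ s ∈ Icc (0:ℝ) T, ∀ x, ∀ u ∈ U, ‖f s x u‖ ≤ c_f * (1 + ‖x‖))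
    (t : ℝ) (ht : t ∈ Icc 0 T) (x : EuclideanSpace ℝ (Fin d))
    (X : ℝ → EuclideanSpace ℝ (Fin d)) (u : ℝ → (Fin r → ℝ)) (hadm : BolzaAdm U f t T x X u) :
    IntervalIntegrable (fun τ => f τ (X τ) (u τ)) volume t T ∧ ContinuousOn X (Icc t T) ∧
      ∀ s ∈ Icc t T, ‖X s‖ ≤ (1 + ‖x‖) * Real.exp (c_f * T) := by
  obtain ⟨hu, huU, hXt, hX⟩ := hadm
  set h : ℝ → EuclideanSpace ℝ (Fin d) := fun τ => f τ (X τ) (u τ) with hh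
  set R := (1 + ‖x‖) * Real.exp (c_f * T) with hR
  have hTI : Icc t T ⊆ Icc 0 T := Icc_subset_Icc_left ht.1
  have hstep : ∀ s ∈ Icc t T, IntervalIntegrable h volume t s →
      ContinuousOn X (Icc t s) ∧ ∀ r ∈ Icc t s, ‖X r‖ ≤ R := by
    intro s hs hint
    have hsub : Icc t s ⊆ Icc t T := Icc_subset_Icc_right hs.2
    obtain ⟨h1, h2⟩ := bz_gronwall h X t s c_f hs.1 hc_f x (fun r hr => hX r (hsub hr))
      (fun r hr => hf_growth r (hTI (hsub hr)) _ _ (huU r)) hint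
    refine ⟨h1, fun r hr => (h2 r hr).trans ?_⟩
    have : r - t ≤ T := by linarith [(hsub hr).2, ht.1]
    rw [hR]
    gcongr
  have hbound : ∀ s ∈ Icc t T, ‖X s‖ ≤ R := by
    intro s hs
    by_cases hint : IntervalIntegrable h volume t s
    · exact (hstep s hs hint).2 s ⟨hs.1, le_rfl⟩
    · rw [hX s hs, intervalIntegral.integral_undef hint, add_zero, hR]
      have h1 : 1 ≤ Real.exp (c_f * T) :=
        Real.one_le_exp (mul_nonneg hc_f.le (ht.1.trans ht.2))
      nlinarith [norm_nonneg x]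
  suffices hint : IntervalIntegrable h volume t T by
    have := hstep T ⟨ht.2, le_rfl⟩ hint
    exact ⟨hint, this.1, hbound⟩
  let A : Set ℝ := {s | s ∈ Icc t T ∧ IntervalIntegrable h volume t s}
  have hAt : t ∈ A := ⟨⟨le_rfl, ht.2⟩, IntervalIntegrable.refl⟩
  have hAb : BddAbove A := ⟨T, fun s hs => hs.1.2⟩
  let S := sSup A
  have hSt : t ≤ S := le_csSup hAb hAt
  have hST : S ≤ T := csSup_le ⟨t, hAt⟩ (fun s hs => hs.1.2)
  have hcontI : ContinuousOn X (Ico t S) := by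
    intro s hs
    obtain ⟨a, haA, hsa⟩ := exists_lt_of_lt_csSup ⟨t, hAt⟩ hs.2
    have h1 := (hstep a haA.1 haA.2).1 s ⟨hs.1, hsa.le⟩
    refine h1.mono_of_mem_nhdsWithin ?_
    have : Iio a ∈ 𝓝 s := Iio_mem_nhds hsa
    rw [mem_nhdsWithin_iff_exists_mem_nhds_inter]
    exact ⟨Iio a, this, fun y hy => ⟨hy.2.1, le_of_lt hy.1⟩⟩
  have hmeas : AEMeasurable X (volume.restrict (Icc t T)) := by
    have hunion : Icc t T ⊆ Ico t S ∪ ({S} ∪ Ioc S T) := by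
      intro s hs
      rcases lt_trichotomy s S with h1 | h1 | h1
      · exact Or.inl ⟨hs.1, h1⟩
      · exact Or.inr (Or.inl h1)
      · exact Or.inr (Or.inr ⟨h1, hs.2⟩)
    refine AEMeasurable.mono_measure ?_ (Measure.restrict_mono_set _ hunion)
    rw [aemeasurable_union_iff, aemeasurable_union_iff]
    refine ⟨hcontI.aemeasurable measurableSet_Ico, ?_, ?_⟩
    · rw [Measure.restrict_eq_zero.mpr (by simp)]
      exact aemeasurable_zero_measure
    · refine (aemeasurable_const (b := x)).congr ?_
      refine (ae_restrict_iff' measurableSet_Ioc).mpr (ae_of_all _ fun s hs => ?_)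
      have hsI : s ∈ Icc t T := ⟨hSt.trans hs.1.le, hs.2⟩
      have hni : ¬ IntervalIntegrable h volume t s := fun hi =>
        absurd (le_csSup hAb (⟨hsI, hi⟩ : s ∈ A)) (not_le.mpr hs.1)
      rw [hX s hsI, intervalIntegral.integral_undef hni, add_zero]
  have hm := bz_aesm U hUc.isClosed T f hf_cont (Icc t T) measurableSet_Icc hTI X hmeas u hu huU
  rw [intervalIntegrable_iff_integrableOn_Icc_of_le ht.2]
  refine Integrable.of_bound hm (c_f * (1 + R)) ?_
  refine (ae_restrict_iff' measurableSet_Icc).mpr (ae_of_all _ fun s hs => ?_)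
  refine (hf_growth s (hTI hs) _ _ (huU s)).trans ?_
  have := hbound s hs
  gcongr

lemma bz_clamp {d : ℕ} (R : ℝ) (hR : 0 < R) :
    ∃ ρ : EuclideanSpace ℝ (Fin d) → EuclideanSpace ℝ (Fin d), ∃ M > 0,
      (∀ x y, ‖ρ x - ρ y‖ ≤ ‖x - y‖) ∧ (∀ x, ‖ρ x‖ ≤ ‖x‖) ∧ (∀ x, ‖ρ x‖ ≤ M) ∧
      ∀ x, ‖x‖ ≤ R → ρ x = x := by
  let ρ : EuclideanSpace ℝ (Fin d) → EuclideanSpace ℝ (Fin d) :=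
    fun x => WithLp.toLp 2 (fun i => max (-R) (min (x i) R))
  have hlip : ∀ x y, ‖ρ x - ρ y‖ ≤ ‖x - y‖ := by
    intro x y
    rw [EuclideanSpace.norm_eq, EuclideanSpace.norm_eq]
    apply Real.sqrt_le_sqrt
    apply Finset.sum_le_sum
    intro i _
    simp only [ρ, PiLp.sub_apply, Real.norm_eq_abs]
    apply pow_le_pow_left₀ (abs_nonneg _)
    rw [abs_sub_le_iff]
    have h1 := le_abs_self (x i - y i)
    have h2 := neg_abs_le (x i - y i)
    constructor <;> grind
  have h0 : ρ 0 = 0 := by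
    ext i
    simp [ρ, hR.le]
  refine ⟨ρ, Real.sqrt (∑ _i : Fin d, R ^ 2) + 1, by positivity, hlip, ?_, ?_, ?_⟩
  · intro x
    have := hlip x 0
    simpa [h0] using this
  · intro x
    refine le_trans ?_ (le_add_of_nonneg_right zero_le_one)
    rw [EuclideanSpace.norm_eq]
    apply Real.sqrt_le_sqrt
    apply Finset.sum_le_sum
    intro i _
    simp only [ρ, Real.norm_eq_abs]
    apply pow_le_pow_left₀ (abs_nonneg _)
    rw [abs_le]
    constructor
    · exact le_max_left _ _
    · exact max_le (by linarith) (min_le_right _ _)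
  · intro x hx
    ext i
    have h1 : ‖x i‖ ≤ ‖x‖ := PiLp.norm_apply_le x i
    rw [Real.norm_eq_abs] at h1
    have h2 := abs_le.mp (h1.trans hx)
    simp only [ρ]
    rw [min_eq_left h2.2, max_eq_right h2.1]

lemma bz_exists {d r : ℕ} (T : ℝ) (U : Set (Fin r → ℝ)) (hUc : IsCompact U) (hUne : U.Nonempty)
    (f : ℝ → EuclideanSpace ℝ (Fin d) → (Fin r → ℝ) → EuclideanSpace ℝ (Fin d))
    (hf_cont : ContinuousOn (fun p : ℝ × EuclideanSpace ℝ (Fin d) × (Fin r → ℝ) =>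
      f p.1 p.2.1 p.2.2) (Icc 0 T ×ˢ univ ×ˢ U))
    (hf_lip : ∀ R > (0:ℝ), ∃ k ≥ (0:ℝ), ∀ s ∈ Icc (0:ℝ) T, ∀ u ∈ U,
      ∀ x y : EuclideanSpace ℝ (Fin d), ‖x‖ ≤ R → ‖y‖ ≤ R →
        ‖f s x u - f s y u‖ ≤ k * ‖x - y‖)
    (c_f : ℝ) (hc_f : 0 < c_f)
    (hf_growth : ∀ s ∈ Icc (0:ℝ) T, ∀ x, ∀ u ∈ U, ‖f s x u‖ ≤ c_f * (1 + ‖x‖))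
    (t : ℝ) (ht : t ∈ Icc 0 T) (x : EuclideanSpace ℝ (Fin d)) :
    ∃ X u, BolzaAdm U f t T x X u := by
  obtain ⟨u0, hu0⟩ := hUne
  obtain ⟨ρ, M, hM, hρl, hρn, hρM, hρe⟩ :=
    bz_clamp (d := d) ((1 + ‖x‖) * Real.exp (c_f * T)) (by positivity)
  obtain ⟨k, hk, hkl⟩ := hf_lip M hM
  have hρc : Continuous ρ := by
    have : LipschitzWith 1 ρ := LipschitzWith.of_dist_le_mul (fun a b => by
      simpa [dist_eq_norm] using hρl a b)
    exact this.continuous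
  have hTI : Icc t T ⊆ Icc 0 T := Icc_subset_Icc_left ht.1
  have hPL : IsPicardLindelof (fun s y => f s (ρ y) u0) (⟨t, le_rfl, ht.2⟩ : Icc t T) x
      ((c_f * (1 + M)) * (T - t)).toNNReal 0 (c_f * (1 + M)).toNNReal k.toNNReal := by
    constructor
    · intro s hs
      refine LipschitzOnWith.of_dist_le_mul fun a _ b _ => ?_
      rw [dist_eq_norm, dist_eq_norm, Real.coe_toNNReal _ hk]
      refine (hkl s (hTI hs) u0 hu0 _ _ (hρM a) (hρM b)).trans ?_
      exact mul_le_mul_of_nonneg_left (hρl a b) hk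
    · intro y _
      refine hf_cont.comp (f := fun s : ℝ => (s, ρ y, u0)) (by fun_prop) ?_
      intro s hs
      exact ⟨hTI hs, mem_univ _, hu0⟩
    · intro s hs y _
      rw [Real.coe_toNNReal _ (by positivity)]
      refine (hf_growth s (hTI hs) _ _ hu0).trans ?_
      have := hρM y
      gcongr
    · have h1 : 0 ≤ T - t := by linarith [ht.2]
      rw [Real.coe_toNNReal _ (by positivity), Real.coe_toNNReal _ (by positivity)]
      simp [h1]
  obtain ⟨α, hα0, hα⟩ := hPL.exists_eq_forall_mem_Icc_eq_picard (x := x) (by simp)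
  have hadm : BolzaAdm U (fun s y u => f s (ρ y) u) t T x α (fun _ => u0) :=
    ⟨measurable_const, fun _ => hu0, hα0, fun s hs => hα s hs⟩
  have hap := bz_apriori T U hUc (fun s y u => f s (ρ y) u) (by
      refine hf_cont.comp (f := fun p : ℝ × EuclideanSpace ℝ (Fin d) × (Fin r → ℝ) =>
        (p.1, ρ p.2.1, p.2.2)) (by fun_prop) ?_
      rintro p ⟨h1, _, h3⟩
      exact ⟨h1, mem_univ _, h3⟩) c_f hc_f (by
      intro s hs y u hu
      refine (hf_growth s hs _ u hu).trans ?_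
      have := hρn y
      gcongr) t ht x α _ hadm
  refine ⟨α, fun _ => u0, measurable_const, fun _ => hu0, hα0, fun s hs => ?_⟩
  rw [hadm.2.2.2 s hs]
  congr 1
  apply intervalIntegral.integral_congr
  intro τ hτ
  rw [uIcc_of_le hs.1] at hτ
  simp only
  rw [hρe _ (hap.2.2 τ ⟨hτ.1, hτ.2.trans hs.2⟩)]

lemma bz_ultralim {W : Type*} [NormedAddCommGroup W] [NormedSpace ℝ W] [FiniteDimensional ℝ W]
    (Y : ℕ → ℝ → W) (L t T : ℝ) (hL0 : 0 ≤ L) (htT : t ≤ T)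
    (hL : ∀ n, ∀ a ∈ Icc t T, ∀ b ∈ Icc t T, ‖Y n b - Y n a‖ ≤ L * |b - a|)
    (y0 : W) (hy0 : ∀ n, Y n t = y0) :
    ∃ Z : ℝ → W, LipschitzWith L.toNNReal Z ∧
      ∀ s ∈ Icc t T, Tendsto (fun n => Y n s) (hyperfilter ℕ : Filter ℕ) (𝓝 (Z s)) := by
  have : ProperSpace W := FiniteDimensional.proper ℝ W
  let cl : ℝ → ℝ := fun r => max t (min r T)
  have hclI : ∀ r, cl r ∈ Icc t T := fun r => ⟨le_max_left _ _, max_le htT (min_le_right _ _)⟩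
  have hcle : ∀ r ∈ Icc t T, cl r = r := fun r hr => by
    simp only [cl]; rw [min_eq_left hr.2, max_eq_right hr.1]
  have hcll : ∀ a b, |cl a - cl b| ≤ |a - b| := by
    intro a b
    have h1 := le_abs_self (a - b)
    have h2 := neg_abs_le (a - b)
    rw [abs_sub_le_iff]
    simp only [cl]
    constructor <;> grind
  have hlim : ∀ s, ∃ w, Tendsto (fun n => Y n (cl s)) (hyperfilter ℕ : Filter ℕ) (𝓝 w) := by
    intro s
    have hmem : ∀ n, Y n (cl s) ∈ closedBall y0 (L * (T - t)) := by
      intro n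
      rw [mem_closedBall, dist_eq_norm, ← hy0 n]
      refine (hL n t ⟨le_rfl, htT⟩ _ (hclI s)).trans ?_
      have h1 := hclI s
      rw [abs_of_nonneg (by linarith [h1.1])]
      gcongr
      exact h1.2
    have hc : IsCompact (closedBall y0 (L * (T - t))) := isCompact_closedBall _ _
    obtain ⟨w, _, hw⟩ := hc.ultrafilter_le_nhds ((hyperfilter ℕ).map (fun n => Y n (cl s)))
      (by
        rw [le_principal_iff]
        exact Filter.mem_map.mpr (Filter.univ_mem' hmem))
    exact ⟨w, hw⟩
  choose Z hZ using hlim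
  refine ⟨Z, ?_, fun s hs => ?_⟩
  · refine LipschitzWith.of_dist_le_mul fun a b => ?_
    rw [Real.coe_toNNReal _ hL0]
    refine le_of_tendsto ((hZ a).dist (hZ b)) (Filter.Eventually.of_forall fun n => ?_)
    rw [dist_eq_norm]
    refine (hL n _ (hclI b) _ (hclI a)).trans ?_
    rw [Real.dist_eq]
    exact mul_le_mul_of_nonneg_left (hcll a b) hL0
  · have := hZ s
    rwa [hcle s hs] at this

lemma bz_limit {d r : ℕ} (T : ℝ)
    (U : Set (Fin r → ℝ)) (hUc : IsCompact U) (hUne : U.Nonempty)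
    (f : ℝ → EuclideanSpace ℝ (Fin d) → (Fin r → ℝ) → EuclideanSpace ℝ (Fin d))
    (l : ℝ → EuclideanSpace ℝ (Fin d) → (Fin r → ℝ) → ℝ)
    (hf_cont : ContinuousOn (fun p : ℝ × EuclideanSpace ℝ (Fin d) × (Fin r → ℝ) =>
      f p.1 p.2.1 p.2.2) (Icc 0 T ×ˢ univ ×ˢ U))
    (c_f : ℝ) (hc_f : 0 < c_f)
    (hf_growth : ∀ s ∈ Icc (0:ℝ) T, ∀ x, ∀ u ∈ U, ‖f s x u‖ ≤ c_f * (1 + ‖x‖))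
    (hl_cont : ContinuousOn (fun p : ℝ × EuclideanSpace ℝ (Fin d) × (Fin r → ℝ) =>
      l p.1 p.2.1 p.2.2) (Icc 0 T ×ˢ univ ×ˢ U))
    (c_l : ℝ) (hc_l : 0 < c_l)
    (hl_growth : ∀ s ∈ Icc (0:ℝ) T, ∀ x, ∀ u ∈ U, |l s x u| ≤ c_l * (1 + ‖x‖))
    (hH4 : ∀ s ∈ Icc (0:ℝ) T, ∀ x : EuclideanSpace ℝ (Fin d),
      Convex ℝ {v : EuclideanSpace ℝ (Fin d) × ℝ | ∃ u ∈ U, ∃ η : ℝ,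
        -c_l * (1 + ‖x‖) + l s x u ≤ η ∧ η ≤ 0 ∧ v = (f s x u, -(l s x u) + η)})
    (t : ℝ) (ht : t ∈ Icc 0 T) (x : EuclideanSpace ℝ (Fin d))
    (X : ℕ → ℝ → EuclideanSpace ℝ (Fin d)) (u : ℕ → ℝ → (Fin r → ℝ))
    (hadm : ∀ n, BolzaAdm U f t T x (X n) (u n)) :
    ∃ (Xb : ℝ → EuclideanSpace ℝ (Fin d)) (ub : ℝ → (Fin r → ℝ)) (lam : ℝ),
      BolzaAdm U f t T x Xb ub ∧
      (∀ s ∈ Icc t T, Tendsto (fun n => X n s) (hyperfilter ℕ : Filter ℕ) (𝓝 (Xb s))) ∧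
      Tendsto (fun n => ∫ s in t..T, l s (X n s) (u n s)) (hyperfilter ℕ : Filter ℕ) (𝓝 lam) ∧
      ∫ s in t..T, l s (Xb s) (ub s) ≤ lam := by
  have hTI : Icc t T ⊆ Icc 0 T := Icc_subset_Icc_left ht.1
  set R := (1 + ‖x‖) * Real.exp (c_f * T) with hR
  have hR0 : 0 < R := by positivity
  set L := c_f * (1 + R) + c_l * (1 + R) with hLdef
  have hL0 : 0 < L := by positivity
  have hap := fun n => bz_apriori T U hUc f hf_cont c_f hc_f hf_growth t ht x (X n) (u n) (hadm n)
  have huU : ∀ n s, u n s ∈ U := fun n => (hadm n).2.1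
  have hXR : ∀ n, ∀ s ∈ Icc t T, ‖X n s‖ ≤ R := fun n => (hap n).2.2
  -- integrability of running cost along continuous bounded trajectories
  have hlint : ∀ (y : ℝ → EuclideanSpace ℝ (Fin d)) (w : ℝ → (Fin r → ℝ)),
      ContinuousOn y (Icc t T) → (∀ s ∈ Icc t T, ‖y s‖ ≤ R) → Measurable w → (∀ s, w s ∈ U) →
      IntervalIntegrable (fun τ => l τ (y τ) (w τ)) volume t T := by
    intro y w hy hyR hw hwU
    have hm := bz_aesm U hUc.isClosed T l hl_cont (Icc t T) measurableSet_Icc hTI y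
      (hy.aemeasurable measurableSet_Icc) w hw hwU
    rw [intervalIntegrable_iff_integrableOn_Icc_of_le ht.2]
    refine Integrable.of_bound hm (c_l * (1 + R)) ?_
    refine (ae_restrict_iff' measurableSet_Icc).mpr (ae_of_all _ fun s hs => ?_)
    refine (hl_growth s (hTI hs) _ _ (hwU s)).trans ?_
    have := hyR s hs
    gcongr
  let v : ℕ → ℝ → EuclideanSpace ℝ (Fin d) × ℝ :=
    fun n τ => (f τ (X n τ) (u n τ), -l τ (X n τ) (u n τ))
  let Y : ℕ → ℝ → EuclideanSpace ℝ (Fin d) × ℝ :=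
    fun n s => (X n s, -∫ τ in t..s, l τ (X n τ) (u n τ))
  have hlI : ∀ n, IntervalIntegrable (fun τ => l τ (X n τ) (u n τ)) volume t T := fun n =>
    hlint (X n) (u n) (hap n).2.1 (hXR n) (hadm n).1 (huU n)
  have hsubI : ∀ a ∈ Icc t T, ∀ b ∈ Icc t T, uIcc a b ⊆ uIcc t T := by
    intro a ha b hb
    rw [uIcc_of_le ht.2]
    exact uIcc_subset_Icc ha hb
  have htI : t ∈ Icc t T := ⟨le_rfl, ht.2⟩
  have hTT : T ∈ Icc t T := ⟨ht.2, le_rfl⟩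
  have hvI0 : ∀ n, IntervalIntegrable (v n) volume t T := by
    intro n
    have h1 := (hap n).1
    have h2 := (hlI n).neg
    rw [intervalIntegrable_iff] at h1 h2 ⊢
    exact Integrable.prodMk h1 h2
  have hvI : ∀ n, ∀ a ∈ Icc t T, ∀ b ∈ Icc t T, IntervalIntegrable (v n) volume a b :=
    fun n a ha b hb => (hvI0 n).mono_set (hsubI a ha b hb)
  have hY : ∀ n, ∀ a ∈ Icc t T, ∀ b ∈ Icc t T, Y n b - Y n a = ∫ τ in a..b, v n τ := by
    intro n a ha b hb
    have e1 := (ContinuousLinearMap.fst ℝ (EuclideanSpace ℝ (Fin d)) ℝ).intervalIntegral_comp_comm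
      (hvI n a ha b hb)
    have e2 := (ContinuousLinearMap.snd ℝ (EuclideanSpace ℝ (Fin d)) ℝ).intervalIntegral_comp_comm
      (hvI n a ha b hb)
    simp only [ContinuousLinearMap.coe_fst', ContinuousLinearMap.coe_snd', v] at e1 e2
    have i1 := fun c hc => (hap n).1.mono_set (hsubI t htI c hc)
    have i2 := fun c hc => (hlI n).mono_set (hsubI t htI c hc)
    apply Prod.ext
    · rw [← e1]
      simp only [Y, Prod.fst_sub]
      rw [(hadm n).2.2.2 a ha, (hadm n).2.2.2 b hb, add_sub_add_left_eq_sub,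
        intervalIntegral.integral_interval_sub_left (i1 b hb) (i1 a ha)]
    · rw [← e2]
      simp only [Y, Prod.snd_sub]
      rw [intervalIntegral.integral_neg,
        ← intervalIntegral.integral_interval_sub_left (i2 b hb) (i2 a ha)]
      ring
  have hvL : ∀ n, ∀ s ∈ Icc t T, ‖v n s‖ ≤ L := by
    intro n s hs
    have h1 := hf_growth s (hTI hs) (X n s) _ (huU n s)
    have h2 := hl_growth s (hTI hs) (X n s) _ (huU n s)
    have h3 := hXR n s hs
    have h4 : c_f * (1 + ‖X n s‖) ≤ c_f * (1 + R) := by gcongr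
    have h5 : c_l * (1 + ‖X n s‖) ≤ c_l * (1 + R) := by gcongr
    have h6 : 0 < c_f * (1 + R) := by positivity
    have h7 : 0 < c_l * (1 + R) := by positivity
    rw [Prod.norm_def]
    apply max_le
    · simp only [v]; linarith
    · simp only [v, norm_neg, Real.norm_eq_abs]; linarith
  have hYL : ∀ n, ∀ a ∈ Icc t T, ∀ b ∈ Icc t T, ‖Y n b - Y n a‖ ≤ L * |b - a| := by
    intro n a ha b hb
    rw [hY n a ha b hb]
    apply intervalIntegral.norm_integral_le_of_norm_le_const
    intro s hs
    exact hvL n s (uIcc_subset_Icc ha hb (uIoc_subset_uIcc hs))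
  have hYt : ∀ n, Y n t = (x, 0) := by
    intro n
    simp only [Y, intervalIntegral.integral_same, neg_zero, (hadm n).2.2.1]
  obtain ⟨Z, hZl, hZ⟩ := bz_ultralim Y L t T hL0.le ht.2 hYL (x, 0) hYt
  have hZt : Z t = (x, 0) := by
    have h1 := hZ t htI
    simp only [hYt] at h1
    exact tendsto_nhds_unique h1 tendsto_const_nhds
  have hX1 : ∀ s ∈ Icc t T, Tendsto (fun n => X n s) (hyperfilter ℕ : Filter ℕ) (𝓝 (Z s).1) :=
    fun s hs => (continuous_fst.tendsto _).comp (hZ s hs)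
  have hZR : ∀ s ∈ Icc t T, ‖(Z s).1‖ ≤ R := fun s hs =>
    le_of_tendsto (hX1 s hs).norm (Filter.Eventually.of_forall fun n => hXR n s hs)
  have hZc : Continuous Z := hZl.continuous
  -- the velocity inclusion
  have hincl : ∀ s ∈ Ioo t T, DifferentiableAt ℝ Z s →
      ∃ w ∈ U, f s (Z s).1 w = (deriv Z s).1 ∧ l s (Z s).1 w ≤ -(deriv Z s).2 := by
    intro s hs hd
    have hsI : s ∈ Icc t T := ⟨hs.1.le, hs.2.le⟩
    set q := (Z s).1 with hq
    set C : Set (EuclideanSpace ℝ (Fin d) × ℝ) := {v | ∃ u ∈ U, ∃ η : ℝ,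
        -c_l * (1 + ‖q‖) + l s q u ≤ η ∧ η ≤ 0 ∧ v = (f s q u, -(l s q u) + η)} with hC
    have hfs : ContinuousOn (fun w => f s q w) U :=
      hf_cont.comp (f := fun w : Fin r → ℝ => (s, q, w)) (by fun_prop)
        (fun w hw => ⟨hTI hsI, mem_univ _, hw⟩)
    have hls : ContinuousOn (fun w => l s q w) U :=
      hl_cont.comp (f := fun w : Fin r → ℝ => (s, q, w)) (by fun_prop)
        (fun w hw => ⟨hTI hsI, mem_univ _, hw⟩)
    have hCc : IsClosed C := by
      have himg : C = (fun p : (Fin r → ℝ) × ℝ =>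
          (f s q p.1, -(l s q p.1) + max (-c_l * (1 + ‖q‖) + l s q p.1) p.2)) ''
          (U ×ˢ Icc (-(2 * (c_l * (1 + ‖q‖)))) 0) := by
        ext p
        constructor
        · rintro ⟨w, hw, η, h1, h2, rfl⟩
          refine ⟨(w, η), ⟨hw, ?_, h2⟩, ?_⟩
          · have := (abs_le.mp (hl_growth s (hTI hsI) q w hw)).1
            simp only
            linarith
          · simp only [max_eq_right h1]
        · rintro ⟨⟨w, η⟩, ⟨hw, h1, h2⟩, rfl⟩
          refine ⟨w, hw, max (-c_l * (1 + ‖q‖) + l s q w) η, le_max_left _ _, max_le ?_ h2, rfl⟩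
          have := (abs_le.mp (hl_growth s (hTI hsI) q w hw)).2
          linarith
      rw [himg]
      refine ((hUc.prod isCompact_Icc).image_of_continuousOn ?_).isClosed
      have g1 : ContinuousOn (fun p : (Fin r → ℝ) × ℝ => f s q p.1)
          (U ×ˢ Icc (-(2 * (c_l * (1 + ‖q‖)))) 0) :=
        hfs.comp continuousOn_fst (fun p hp => hp.1)
      have g2 : ContinuousOn (fun p : (Fin r → ℝ) × ℝ => l s q p.1)
          (U ×ˢ Icc (-(2 * (c_l * (1 + ‖q‖)))) 0) :=
        hls.comp continuousOn_fst (fun p hp => hp.1)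
      exact g1.prodMk (g2.neg.add (ContinuousOn.sup (continuousOn_const.add g2) continuousOn_snd))
    have hmem : deriv Z s ∈ C := by
      refine bz_deriv_mem (hyperfilter ℕ) v Y Z t T s ⟨hs.1.le, hs.2⟩ hvI hY hZ _ hd.hasDerivAt C
        (hH4 s (hTI hsI) q) hCc ?_
      intro ε hε
      have hK : IsCompact (Icc 0 T ×ˢ closedBall (0 : EuclideanSpace ℝ (Fin d)) R ×ˢ U) :=
        isCompact_Icc.prod ((isCompact_closedBall _ _).prod hUc)
      have hKc : ContinuousOn (fun p : ℝ × EuclideanSpace ℝ (Fin d) × (Fin r → ℝ) =>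
          (f p.1 p.2.1 p.2.2, -l p.1 p.2.1 p.2.2))
          (Icc 0 T ×ˢ closedBall (0 : EuclideanSpace ℝ (Fin d)) R ×ˢ U) :=
        (hf_cont.prodMk hl_cont.neg).mono
          (prod_mono le_rfl (prod_mono (subset_univ _) le_rfl))
      have huc := hK.uniformContinuousOn_of_continuous hKc
      rw [Metric.uniformContinuousOn_iff] at huc
      obtain ⟨δ, hδ, hδε⟩ := huc ε hε
      have hδ1 : 0 < δ / (2 * (L + 1)) := by positivity
      have hδ2 : L * (δ / (2 * (L + 1))) < δ / 2 := by
        rw [← mul_div_assoc, div_lt_div_iff₀ (by positivity) (by positivity)]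
        nlinarith
      have hδ3 : δ / (2 * (L + 1)) < δ := by
        rw [div_lt_iff₀ (by positivity)]
        nlinarith
      refine ⟨δ / (2 * (L + 1)), hδ1, ?_⟩
      have hev := (Metric.tendsto_nhds.mp (hZ s hsI)) (δ / 2) (by positivity)
      filter_upwards [hev] with n hn τ hτ hτT
      have hτI : τ ∈ Icc t T := ⟨hs.1.le.trans hτ.1, hτT⟩
      refine mem_cthickening_of_dist_le (v n τ) (f s q (u n τ), -l s q (u n τ)) ε C ?_ ?_
      · refine ⟨u n τ, huU n τ, 0, ?_, le_rfl, by simp⟩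
        have := (abs_le.mp (hl_growth s (hTI hsI) q _ (huU n τ))).2
        linarith
      · refine (hδε (τ, X n τ, u n τ) ⟨hTI hτI, ?_, huU n τ⟩ (s, q, u n τ)
          ⟨hTI hsI, ?_, huU n τ⟩ ?_).le
        · simpa using hXR n τ hτI
        · simpa using hZR s hsI
        · have h1 : |τ - s| ≤ δ / (2 * (L + 1)) := by
            rw [abs_of_nonneg (by linarith [hτ.1])]
            linarith [hτ.2]
          have h2 : dist (X n τ) q < δ := by
            have a1 : dist (X n τ) q ≤ dist (Y n τ) (Z s) := by
              rw [Prod.dist_eq]; exact le_max_left _ _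
            have a2 := dist_triangle (Y n τ) (Y n s) (Z s)
            have a3 := hYL n s hsI τ hτI
            rw [← dist_eq_norm] at a3
            have a4 : L * |τ - s| ≤ L * (δ / (2 * (L + 1))) := by gcongr
            linarith
          rw [Prod.dist_eq, Prod.dist_eq]
          simp only [dist_self, Real.dist_eq]
          exact max_lt (by linarith) (max_lt h2 hδ)
    obtain ⟨w, hw, η, h1, h2, h3⟩ := hmem
    refine ⟨w, hw, ?_, ?_⟩
    · rw [h3]
    · rw [h3]; simp only; linarith
  -- measurable selection
  have hKcl : IsClosed {q : (ℝ × (EuclideanSpace ℝ (Fin d) × ℝ)) × (Fin r → ℝ) |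
      (q.1.1 ∈ Icc t T ∧ q.2 ∈ U) ∧ f q.1.1 (Z q.1.1).1 q.2 - q.1.2.1 = 0 ∧
        l q.1.1 (Z q.1.1).1 q.2 + q.1.2.2 ≤ 0} := by
    have hS : IsClosed {q : (ℝ × (EuclideanSpace ℝ (Fin d) × ℝ)) × (Fin r → ℝ) |
        q.1.1 ∈ Icc t T ∧ q.2 ∈ U} :=
      (isClosed_Icc.preimage (by fun_prop : Continuous fun q :
        (ℝ × (EuclideanSpace ℝ (Fin d) × ℝ)) × (Fin r → ℝ) => q.1.1)).inter
        (hUc.isClosed.preimage continuous_snd)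
    have hmap : MapsTo (fun q : (ℝ × (EuclideanSpace ℝ (Fin d) × ℝ)) × (Fin r → ℝ) =>
        (q.1.1, (Z q.1.1).1, q.2)) {q | q.1.1 ∈ Icc t T ∧ q.2 ∈ U} (Icc 0 T ×ˢ univ ×ˢ U) :=
      fun q hq => ⟨hTI hq.1, mem_univ _, hq.2⟩
    have hcm : ContinuousOn (fun q : (ℝ × (EuclideanSpace ℝ (Fin d) × ℝ)) × (Fin r → ℝ) =>
        (q.1.1, (Z q.1.1).1, q.2)) {q | q.1.1 ∈ Icc t T ∧ q.2 ∈ U} := by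
      fun_prop
    have k1 := hf_cont.comp hcm hmap
    have k2 := hl_cont.comp hcm hmap
    have k3 := (k1.sub (by fun_prop : ContinuousOn (fun q :
        (ℝ × (EuclideanSpace ℝ (Fin d) × ℝ)) × (Fin r → ℝ) => q.1.2.1) _)).prodMk
      (k2.add (by fun_prop : ContinuousOn (fun q :
        (ℝ × (EuclideanSpace ℝ (Fin d) × ℝ)) × (Fin r → ℝ) => q.1.2.2) _))
    exact k3.preimage_isClosed_of_isClosed hS
      ((isClosed_singleton (x := (0 : EuclideanSpace ℝ (Fin d)))).prod (isClosed_Iic (a := (0:ℝ))))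
  obtain ⟨σ, hσm, hσU, hσ⟩ := bz_selection U hUc hUne _ hKcl
  let ub : ℝ → (Fin r → ℝ) := fun s => σ (s, deriv Z s)
  have hubm : Measurable ub := hσm.comp (measurable_id.prodMk (measurable_deriv Z))
  have hubU : ∀ s, ub s ∈ U := fun s => hσU _
  have hub : ∀ s ∈ Ioo t T, DifferentiableAt ℝ Z s →
      f s (Z s).1 (ub s) = (deriv Z s).1 ∧ l s (Z s).1 (ub s) ≤ -(deriv Z s).2 := by
    intro s hs hd
    obtain ⟨w, hw, h1, h2⟩ := hincl s hs hd
    have := hσ (s, deriv Z s) w hw ⟨⟨⟨hs.1.le, hs.2.le⟩, hw⟩, by simp [h1], by simp only; linarith⟩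
    exact ⟨sub_eq_zero.mp this.2.1, by have := this.2.2; simp only at this; linarith⟩
  have hne : ∀ᵐ s : ℝ, s ≠ T := by
    simp [ae_iff]
  refine ⟨fun s => (Z s).1, ub, -(Z T).2, ⟨hubm, hubU, by simp [hZt], ?_⟩, hX1, ?_, ?_⟩
  · intro s hs
    obtain ⟨i1, i2⟩ := bz_ftc Z hZl t s
    have e1 := (ContinuousLinearMap.fst ℝ (EuclideanSpace ℝ (Fin d)) ℝ).intervalIntegral_comp_comm i1
    rw [i2, hZt] at e1
    simp only [ContinuousLinearMap.coe_fst', Prod.fst_sub] at e1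
    have e2 : ∫ τ in t..s, f τ (Z τ).1 (ub τ) = ∫ τ in t..s, (deriv Z τ).1 := by
      apply intervalIntegral.integral_congr_ae
      filter_upwards [hZl.ae_differentiableAt_real, hne] with τ h1 h2 h3
      rw [uIoc_of_le hs.1] at h3
      exact (hub τ ⟨h3.1, lt_of_le_of_ne (h3.2.trans hs.2) h2⟩ h1).1
    rw [e2, e1]
    simp
  · have := ((continuous_snd.tendsto _).comp (hZ T hTT)).neg
    refine this.congr fun n => ?_
    simp [Y]
  · obtain ⟨i1, i2⟩ := bz_ftc Z hZl t T
    have e1 := (ContinuousLinearMap.snd ℝ (EuclideanSpace ℝ (Fin d)) ℝ).intervalIntegral_comp_comm i1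
    rw [i2, hZt] at e1
    simp only [ContinuousLinearMap.coe_snd', Prod.snd_sub, sub_zero] at e1
    rw [← e1, ← intervalIntegral.integral_neg]
    apply intervalIntegral.integral_mono_ae_restrict ht.2
    · exact hlint _ ub (by fun_prop) hZR hubm hubU
    · have := (ContinuousLinearMap.snd ℝ (EuclideanSpace ℝ (Fin d)) ℝ).integrable_comp i1.1
      have i3 : IntervalIntegrable (fun s => (deriv Z s).2) volume t T := by
        rw [intervalIntegrable_iff_integrableOn_Ioc_of_le ht.2]
        exact this
      exact i3.neg
    · refine (ae_restrict_iff' measurableSet_Icc).mpr ?_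
      have hne' : ∀ᵐ s : ℝ, s ≠ t := by
        simp [ae_iff]
      filter_upwards [hZl.ae_differentiableAt_real, hne, hne'] with τ h1 h2 h2' h3
      exact (hub τ ⟨lt_of_le_of_ne h3.1 (Ne.symm h2'), lt_of_le_of_ne h3.2 h2⟩ h1).2

/-- **Equivalence between the constrained Bolza value and the auxiliary value.**
Under (H0)–(H4), `𝒱(t,x) ≤ z ⟺ 𝒲(t,x,z) ≤ 0`. -/
theorem constrainedValue_le_iff_auxValue_nonpos
    (T : ℝ) (hT : 0 < T)
    -- (H0)
    (U : Set (Fin r → ℝ)) (hUc : IsCompact U) (hUne : U.Nonempty)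
    (f : ℝ → EuclideanSpace ℝ (Fin d) → (Fin r → ℝ) → EuclideanSpace ℝ (Fin d))
    (l : ℝ → EuclideanSpace ℝ (Fin d) → (Fin r → ℝ) → ℝ)
    -- (H1a)
    (hf_cont : ContinuousOn (fun p : ℝ × EuclideanSpace ℝ (Fin d) × (Fin r → ℝ) =>
      f p.1 p.2.1 p.2.2) (Icc 0 T ×ˢ univ ×ˢ U))
    (hf_lip : ∀ R > (0:ℝ), ∃ k ≥ (0:ℝ), ∀ s ∈ Icc (0:ℝ) T, ∀ u ∈ U,
      ∀ x y : EuclideanSpace ℝ (Fin d), ‖x‖ ≤ R → ‖y‖ ≤ R →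
        ‖f s x u - f s y u‖ ≤ k * ‖x - y‖)
    (c_f : ℝ) (hc_f : 0 < c_f)
    (hf_growth : ∀ s ∈ Icc (0:ℝ) T, ∀ x, ∀ u ∈ U, ‖f s x u‖ ≤ c_f * (1 + ‖x‖))
    -- (H1b)
    (hl_cont : ContinuousOn (fun p : ℝ × EuclideanSpace ℝ (Fin d) × (Fin r → ℝ) =>
      l p.1 p.2.1 p.2.2) (Icc 0 T ×ˢ univ ×ˢ U))
    (hl_lip : ∀ R > (0:ℝ), ∃ k ≥ (0:ℝ), ∀ s ∈ Icc (0:ℝ) T, ∀ u ∈ U,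
      ∀ x y : EuclideanSpace ℝ (Fin d), ‖x‖ ≤ R → ‖y‖ ≤ R →
        |l s x u - l s y u| ≤ k * ‖x - y‖)
    (c_l : ℝ) (hc_l : 0 < c_l)
    (hl_growth : ∀ s ∈ Icc (0:ℝ) T, ∀ x, ∀ u ∈ U, |l s x u| ≤ c_l * (1 + ‖x‖))
    -- (H2)
    (φ : EuclideanSpace ℝ (Fin d) → ℝ) (hφ_lip : LocallyLipschitz φ)
    (c_φ : ℝ) (hc_φ : 0 ≤ c_φ) (hφ_growth : ∀ y, |φ y| ≤ c_φ * (1 + ‖y‖))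
    -- (H3)
    (g : EuclideanSpace ℝ (Fin d) → Fin mg → ℝ)
    (g_f : EuclideanSpace ℝ (Fin d) → Fin mf → ℝ)
    (hg_lip : LocallyLipschitz g) (hgf_lip : LocallyLipschitz g_f)
    (c_g : ℝ) (hc_g : 0 ≤ c_g)
    (hg_growth : ∀ y, ‖g y‖ + ‖g_f y‖ ≤ c_g * (1 + ‖y‖))
    -- (H4): convexity of the augmented velocity set
    (hH4 : ∀ s ∈ Icc (0:ℝ) T, ∀ x : EuclideanSpace ℝ (Fin d),
      Convex ℝ {v : EuclideanSpace ℝ (Fin d) × ℝ | ∃ u ∈ U, ∃ η : ℝ,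
        -c_l * (1 + ‖x‖) + l s x u ≤ η ∧ η ≤ 0 ∧ v = (f s x u, -(l s x u) + η)})
    (t : ℝ) (ht : t ∈ Icc 0 T) (x : EuclideanSpace ℝ (Fin d)) (z : ℝ) :
    ConstrainedBolzaValue U f l φ g g_f T t x ≤ (z : EReal)
      ↔ AuxValue U f l φ g g_f T t x z ≤ 0 := by
  constructor
  · intro hV
    by_contra hW
    push Not at hW
    unfold AuxValue at hW
    set S : Set ℝ := {c : ℝ | ∃ traj u, BolzaAdm U f t T x traj u ∧
      c = max (φ (traj T) + (∫ s in t..T, l s (traj s) (u s)) - z)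
          (max (sSup ((fun θ => ⨆ i, g (traj θ) i) '' Icc t T))
               (⨆ j, g_f (traj T) j))} with hS
    have hbdd : BddBelow S := by
      by_contra hb
      rw [Real.sInf_of_not_bddBelow hb] at hW
      exact lt_irrefl _ hW
    have hlt : ConstrainedBolzaValue U f l φ g g_f T t x < ((z + sInf S : ℝ) : EReal) :=
      lt_of_le_of_lt hV (by exact_mod_cast (by linarith : z < z + sInf S))
    unfold ConstrainedBolzaValue at hlt
    obtain ⟨c, ⟨X, u, hadm, hg, hgf, rfl⟩, hc⟩ := sInf_lt_iff.mp hlt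
    have hc' : φ (X T) + ∫ s in t..T, l s (X s) (u s) < z + sInf S := by exact_mod_cast hc
    have hle := csInf_le hbdd (⟨X, u, hadm, rfl⟩ : _ ∈ S)
    refine absurd hle (not_le.mpr ?_)
    have h1 : sSup ((fun θ => ⨆ i, g (X θ) i) '' Icc t T) ≤ 0 := by
      apply Real.sSup_nonpos
      rintro _ ⟨θ, hθ, rfl⟩
      exact Real.iSup_nonpos (hg θ hθ)
    have h2 : (⨆ j, g_f (X T) j) ≤ 0 := Real.iSup_nonpos hgf
    exact max_lt (by linarith) (max_lt (by linarith) (by linarith))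
  · intro hW
    unfold AuxValue at hW
    set S : Set ℝ := {c : ℝ | ∃ traj u, BolzaAdm U f t T x traj u ∧
      c = max (φ (traj T) + (∫ s in t..T, l s (traj s) (u s)) - z)
          (max (sSup ((fun θ => ⨆ i, g (traj θ) i) '' Icc t T))
               (⨆ j, g_f (traj T) j))} with hS
    have hne : S.Nonempty := by
      obtain ⟨X, u, h⟩ := bz_exists T U hUc hUne f hf_cont hf_lip c_f hc_f hf_growth t ht x
      exact ⟨_, X, u, h, rfl⟩
    have hseq : ∀ n : ℕ, ∃ c ∈ S, c < 1 / ((n : ℝ) + 1) := by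
      intro n
      have hpos : (0:ℝ) < 1 / ((n : ℝ) + 1) := by positivity
      by_cases hb : BddBelow S
      · exact exists_lt_of_csInf_lt hne (lt_of_le_of_lt hW hpos)
      · rw [not_bddBelow_iff] at hb
        exact hb _
    have hseq' : ∀ n : ℕ, ∃ X u, BolzaAdm U f t T x X u ∧
        max (φ (X T) + (∫ s in t..T, l s (X s) (u s)) - z)
          (max (sSup ((fun θ => ⨆ i, g (X θ) i) '' Icc t T))
               (⨆ j, g_f (X T) j)) < 1 / ((n : ℝ) + 1) := by
      intro n
      obtain ⟨c, ⟨X, u, h, rfl⟩, hc⟩ := hseq n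
      exact ⟨X, u, h, hc⟩
    choose X u hadm hcost using hseq'
    obtain ⟨Xb, ub, lam, hb1, hb2, hb3, hb4⟩ := bz_limit T U hUc hUne f l hf_cont c_f hc_f
      hf_growth hl_cont c_l hc_l hl_growth hH4 t ht x X u hadm
    have hTT : T ∈ Icc t T := ⟨ht.2, le_rfl⟩
    have hlim0 : Tendsto (fun n : ℕ => 1 / ((n : ℝ) + 1)) (hyperfilter ℕ : Filter ℕ) (𝓝 0) :=
      tendsto_one_div_add_atTop_nhds_zero_nat.mono_left Nat.hyperfilter_le_atTop
    have hgc : Continuous g := hg_lip.continuous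
    have hgfc : Continuous g_f := hgf_lip.continuous
    have hφc : Continuous φ := hφ_lip.continuous
    have hgn : ∀ n, ∀ s ∈ Icc t T, ∀ i, g (X n s) i ≤ 1 / ((n : ℝ) + 1) := by
      intro n s hs i
      have h1 := ((le_max_left _ _).trans (le_max_right _ _)).trans (hcost n).le
      have hXR := (bz_apriori T U hUc f hf_cont c_f hc_f hf_growth t ht x (X n) (u n)
        (hadm n)).2.2
      have hbd : BddAbove ((fun θ => ⨆ i, g (X n θ) i) '' Icc t T) := by
        refine ⟨c_g * (1 + (1 + ‖x‖) * Real.exp (c_f * T)), ?_⟩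
        rintro _ ⟨θ, hθ, rfl⟩
        have hRp : 0 ≤ c_g * (1 + (1 + ‖x‖) * Real.exp (c_f * T)) := by positivity
        refine Real.iSup_le (fun j => ?_) hRp
        have a1 := hg_growth (X n θ)
        have a2 := norm_le_pi_norm (g (X n θ)) j
        have a3 := le_abs_self (g (X n θ) j)
        rw [Real.norm_eq_abs] at a2
        have a4 := norm_nonneg (g_f (X n θ))
        have a5 : c_g * (1 + ‖X n θ‖) ≤ c_g * (1 + (1 + ‖x‖) * Real.exp (c_f * T)) := by
          have := hXR θ hθ
          gcongr
        linarith
      have h2 := le_csSup hbd ⟨s, hs, rfl⟩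
      have h3 : g (X n s) i ≤ ⨆ i, g (X n s) i :=
        le_ciSup (Set.finite_range _).bddAbove i
      exact h3.trans (h2.trans h1)
    have hgfn : ∀ n, ∀ j, g_f (X n T) j ≤ 1 / ((n : ℝ) + 1) := by
      intro n j
      have h1 := ((le_max_right _ _).trans (le_max_right _ _)).trans (hcost n).le
      exact (le_ciSup (Set.finite_range _).bddAbove j).trans h1
    have hφn : ∀ n, φ (X n T) + (∫ s in t..T, l s (X n s) (u n s)) - z ≤ 1 / ((n : ℝ) + 1) :=
      fun n => (le_max_left _ _).trans (hcost n).le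
    have hfin : φ (Xb T) + lam - z ≤ 0 :=
      le_of_tendsto_of_tendsto' ((((hφc.tendsto _).comp (hb2 T hTT)).add hb3).sub_const z) hlim0 hφn
    unfold ConstrainedBolzaValue
    refine le_trans (sInf_le (a := ((φ (Xb T) + ∫ s in t..T, l s (Xb s) (ub s) : ℝ) : EReal))
      ⟨Xb, ub, hb1, ?_, ?_, rfl⟩) ?_
    · intro s hs i
      have : Tendsto (fun n => g (X n s) i) (hyperfilter ℕ : Filter ℕ) (𝓝 (g (Xb s) i)) :=
        (((continuous_apply i).comp hgc).tendsto _).comp (hb2 s hs)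
      exact le_of_tendsto_of_tendsto' this hlim0 (fun n => hgn n s hs i)
    · intro j
      have : Tendsto (fun n => g_f (X n T) j) (hyperfilter ℕ : Filter ℕ) (𝓝 (g_f (Xb T) j)) :=
        (((continuous_apply j).comp hgfc).tendsto _).comp (hb2 T hTT)
      exact le_of_tendsto_of_tendsto' this hlim0 (fun n => hgfn n j)
    · exact_mod_cast (by linarith : φ (Xb T) + ∫ s in t..T, l s (Xb s) (ub s) ≤ z)
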